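/- Let m ≥ 2 and let g ∈ L_m be fundamental. Suppose σ and κ are α-sequences such that α = g_e σ and β = g_o κ both belong to L_{2m} and α and β are adjacent in L_{2m} with α < β. Then g_o σ ∈ L_{2m}. -/

import Mathlib

/-!
Common definitions: α-sequences, the lexical order, elementary operations,
lexical sequences, harmonics, star products, etc.
-/

/-- The sign-alternating sequence `Al(τ)` associated to an α-sequence `τ`
(0-indexed: entry `i` of `Al τ` is `(-1)^i * τ_{i+1}`, and `0` beyond the length). -/
def Al (τ : List ℕ) (i : ℕ) : ℤ := (-1 : ℤ) ^ i * (τ.getD i 0 : ℤ)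

/-- The (strict) lexical order: `τ < τ'` iff the first nonzero entry of
`Al τ - Al τ'` is negative. -/
def lexLt (τ τ' : List ℕ) : Prop :=
  ∃ i, (∀ j < i, Al τ j = Al τ' j) ∧ Al τ i < Al τ' i

/-- An α-sequence: a nonempty finite sequence of positive integers. -/
def IsAlphaSeq (α : List ℕ) : Prop := α ≠ [] ∧ ∀ x ∈ α, 0 < x

/-- `Aset n` is the set `A_n` of α-sequences of degree `n`. -/
def Aset (n : ℕ) : Set (List ℕ) := {α | IsAlphaSeq α ∧ α.sum = n}

/-- Splitting operation `E_s` at the (1-indexed) cell `i`: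
`(α₁,…,α_{i-1}, α_i - 1, 1, α_{i+1},…,α_k)`. -/
def applyEs (α : List ℕ) (i : ℕ) : List ℕ :=
  α.take (i - 1) ++ [α.getD (i - 1) 0 - 1, 1] ++ α.drop i

/-- `E_s` is applicable at cell `i` iff `1 ≤ i ≤ l(α)` and `α_i > 1`. -/
def EsApplicable (α : List ℕ) (i : ℕ) : Prop :=
  1 ≤ i ∧ i ≤ α.length ∧ 1 < α.getD (i - 1) 0

/-- Conjugation operation `E_c` at the (1-indexed) cell `i`:
`(α₁,…,α_{i-2}, α_{i-1} + 1, α_{i+1},…,α_k)`. -/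
def applyEc (α : List ℕ) (i : ℕ) : List ℕ :=
  α.take (i - 2) ++ [α.getD (i - 2) 0 + 1] ++ α.drop i

/-- `E_c` is applicable at cell `i` iff `2 ≤ i ≤ l(α)` and `α_i = 1`. -/
def EcApplicable (α : List ℕ) (i : ℕ) : Prop :=
  2 ≤ i ∧ i ≤ α.length ∧ α.getD (i - 1) 0 = 1

/-- `α'` is obtained from `α` by applying one elementary operation (`E_s` or `E_c`)
at the (1-indexed) cell `i`. -/
def ElemOpAt (α : List ℕ) (i : ℕ) (α' : List ℕ) : Prop :=
  (EsApplicable α i ∧ α' = applyEs α i) ∨ (EcApplicable α i ∧ α' = applyEc α i)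

/-- `a < b` and `a`, `b` are adjacent in `S`: no element of `S` lies strictly between. -/
def AdjLtIn (S : Set (List ℕ)) (a b : List ℕ) : Prop :=
  lexLt a b ∧ ∀ γ ∈ S, ¬ (lexLt a γ ∧ lexLt γ b)

/-- An α-sequence is lexical iff it strictly exceeds all of its proper right sequences. -/
def IsLexical (α : List ℕ) : Prop :=
  IsAlphaSeq α ∧ ∀ i, 2 ≤ i → i ≤ α.length → lexLt (α.drop (i - 1)) α

/-- `Lset n` is the set `L_n` of lexical sequences `α` with `1 + D(α) = n`. -/
def Lset (n : ℕ) : Set (List ℕ) := {α | IsLexical α ∧ 1 + α.sum = n}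

/-- Add `1` to the last entry of a list. -/
def bumpLast (α : List ℕ) : List ℕ := α.dropLast ++ [α.getD (α.length - 1) 0 + 1]

/-- `α_e`: the even-length modification of `α`. -/
def seqE (α : List ℕ) : List ℕ := if Even α.length then bumpLast α else α ++ [1]

/-- `α_o`: the odd-length modification of `α`. -/
def seqO (α : List ℕ) : List ℕ := if Even α.length then α ++ [1] else bumpLast α

/-- The `j`-th harmonicSeq: `h_0(α) = α` and `h_j(α) = (h_{j-1}(α))_o h_{j-1}(α)`. -/
def harmonicSeq : ℕ → List ℕ → List ℕ
  | 0, α => α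
  | j + 1, α => seqO (harmonicSeq j α) ++ harmonicSeq j α

/-- A sequence is fundamental iff it is not a harmonicSeq `h_j(β)`, `j ≥ 1`,
of any α-sequence `β`. -/
def IsFundamental (α : List ℕ) : Prop :=
  ∀ β : List ℕ, IsAlphaSeq β → ∀ j, 1 ≤ j → α ≠ harmonicSeq j β

/-- `α^q`: the `q`-fold concatenation of `α` with itself. -/
def nrep (α : List ℕ) (q : ℕ) : List ℕ := (List.replicate q α).flatten

/-- The star product
`α ⋆ β = α_o (α_e)^{β₁-1} α_o (α_e)^{β₂-1} ⋯ α_o (α_e)^{β_k-1} α`. -/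
def starProd (α β : List ℕ) : List ℕ :=
  (β.map (fun b => seqO α ++ nrep (seqE α) (b - 1))).flatten ++ α

/-- `α ∧ β`: the longest common left factor, ended by the minimum of the
first differing entries. -/
def wedge : List ℕ → List ℕ → List ℕ
  | [], _ => []
  | _, [] => []
  | a :: as, b :: bs => if a = b then a :: wedge as bs else [min a b]

/-- `a` is the least element of `S` in the lexical order. -/
def LeastIn (S : Set (List ℕ)) (a : List ℕ) : Prop :=
  a ∈ S ∧ ∀ b ∈ S, b ≠ a → lexLt a b

/-- `a` is the greatest element of `S` in the lexical order. -/
def GreatestIn (S : Set (List ℕ)) (a : List ℕ) : Prop :=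
  a ∈ S ∧ ∀ b ∈ S, b ≠ a → lexLt b a

/-- `i` is an even (1-indexed) cell of `α` at which the applicable elementary
operation yields a lexical sequence. -/
def GoodEvenIndex (α : List ℕ) (i : ℕ) : Prop :=
  Even i ∧ ∃ α', ElemOpAt α i α' ∧ IsLexical α'

/-- `i` is an odd (1-indexed) cell of `α` at which the applicable elementary
operation yields a lexical sequence. -/
def GoodOddIndex (α : List ℕ) (i : ℕ) : Prop :=
  Odd i ∧ ∃ α', ElemOpAt α i α' ∧ IsLexical α'

/-- The successor operation: apply whichever of `E_s`, `E_c` is applicable at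
the largest even (1-indexed) index `≤ l(α)`, i.e. on the tail of the longest
left sequence of even length. -/
def succOp (α : List ℕ) : List ℕ :=
  let i := if Even α.length then α.length else α.length - 1
  if 1 < α.getD (i - 1) 0 then applyEs α i else applyEc α i

/-- The sign of a word over `{-1, 0, 1}`: `-1` to the number of letters equal to `1`. -/
def par (l : List ℤ) : ℤ := (l.map fun a => if a = 1 then (-1 : ℤ) else 1).prod

/-- The twisted strict order on words: compare at the first difference, with the
order reversed when the common prefix contains an odd number of letters `1`.
A word and a prefix of it are incomparable. -/
def Slt (x y : List ℤ) : Prop :=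
  ∃ τ a b x' y', x = τ ++ a :: x' ∧ y = τ ++ b :: y' ∧ par τ * a < par τ * b

/-- All letters are `1` or `-1`. -/
def Bin (x : List ℤ) : Prop := ∀ a ∈ x, a = 1 ∨ a = -1

/-- `z` is shift-maximal: every proper right factor, ended by `0`, lies below `z`. -/
def WLex (z : List ℤ) : Prop := ∀ p u, z = p ++ u → p ≠ [] → Slt (u ++ [0]) z

/-- No right factor of `x` exceeds `s`. -/
def Wadm (s x : List ℤ) : Prop := ∀ ρ, ρ <:+ x → ¬ Slt s ρ

@[simp] lemma par_nil : par [] = 1 := rfl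

@[simp] lemma par_append (x y : List ℤ) : par (x ++ y) = par x * par y := by
  simp [par]

@[simp] lemma par_cons (a : ℤ) (y : List ℤ) :
    par (a :: y) = (if a = 1 then -1 else 1) * par y := by
  simp [par]

lemma par_cases (x : List ℤ) : par x = 1 ∨ par x = -1 := by
  induction x with
  | nil => simp
  | cons a x ih => rw [par_cons]; split_ifs <;> omega

@[simp] lemma bin_nil : Bin [] := by simp [Bin]

@[simp] lemma bin_cons {a : ℤ} {x : List ℤ} : Bin (a :: x) ↔ (a = 1 ∨ a = -1) ∧ Bin x := by
  simp [Bin]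

@[simp] lemma bin_append {x y : List ℤ} : Bin (x ++ y) ↔ Bin x ∧ Bin y := by
  simp [Bin, or_imp, forall_and]

@[simp] lemma not_slt_nil_left (y : List ℤ) : ¬ Slt [] y := by
  rintro ⟨τ, a, b, x', y', h, -⟩; simp at h

@[simp] lemma not_slt_nil_right (x : List ℤ) : ¬ Slt x [] := by
  rintro ⟨τ, a, b, x', y', -, h, -⟩; simp at h

lemma slt_cons {a b : ℤ} {x y : List ℤ} :
    Slt (a :: x) (b :: y) ↔ a < b ∨ (a = b ∧ ((a = 1 ∧ Slt y x) ∨ (a ≠ 1 ∧ Slt x y))) := by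
  constructor
  · rintro ⟨_ | ⟨c, τ⟩, a', b', x', y', h1, h2, h3⟩
    · simp at h1 h2 h3; left; omega
    · simp only [List.cons_append, List.cons.injEq] at h1 h2
      obtain ⟨rfl, rfl⟩ := h1
      obtain ⟨rfl, rfl⟩ := h2
      right
      refine ⟨rfl, ?_⟩
      rw [par_cons] at h3
      split_ifs at h3 with hc
      · exact Or.inl ⟨hc, τ, b', a', y', x', rfl, rfl, by linarith⟩
      · exact Or.inr ⟨hc, τ, a', b', x', y', rfl, rfl, by linarith⟩
  · rintro (h | ⟨rfl, ⟨rfl, τ, a', b', x', y', rfl, rfl, h⟩ | ⟨hc, τ, a', b', x', y', rfl, rfl, h⟩⟩)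
    · exact ⟨[], a, b, x, y, rfl, rfl, by simpa using h⟩
    · exact ⟨1 :: τ, b', a', y', x', rfl, rfl, by rw [par_cons, if_pos rfl]; linarith⟩
    · exact ⟨a :: τ, a', b', x', y', rfl, rfl, by rw [par_cons, if_neg hc]; linarith⟩

lemma slt_append_left_even {τ x y : List ℤ} (h : par τ = 1) :
    Slt (τ ++ x) (τ ++ y) ↔ Slt x y := by
  suffices H : (par τ = 1 → (Slt (τ ++ x) (τ ++ y) ↔ Slt x y)) ∧
      (par τ = -1 → (Slt (τ ++ x) (τ ++ y) ↔ Slt y x)) from H.1 h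
  clear h
  induction τ generalizing x y with
  | nil => simp
  | cons a τ ih =>
    have ih1 := @ih x y
    have ih2 := @ih y x
    rw [par_cons]
    simp only [List.cons_append, slt_cons]
    by_cases ha : a = 1 <;> simp [ha] <;> grind

lemma slt_append_left_odd {τ x y : List ℤ} (h : par τ = -1) :
    Slt (τ ++ x) (τ ++ y) ↔ Slt y x := by
  induction τ generalizing x y with
  | nil => simp at h
  | cons a τ ih =>
    rw [par_cons] at h
    simp only [List.cons_append, slt_cons]
    have := par_cases τ
    by_cases ha : a = 1
    · have h' : par τ = 1 := by simp [ha] at h; omega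
      simp [ha, slt_append_left_even h']
    · simp [ha] at h
      simp [ha, ih h]

lemma slt_trans {x y z : List ℤ} (h : Slt x y) (h' : Slt y z) : Slt x z := by
  suffices H : (Slt x y → Slt y z → Slt x z) ∧ (Slt z y → Slt y x → Slt z x) from H.1 h h'
  clear h h'
  induction y generalizing x z with
  | nil => simp
  | cons b y ih =>
    rcases x with _ | ⟨a, x⟩
    · simp
    rcases z with _ | ⟨c, z⟩
    · simp
    have ih1 := @ih x z
    have ih2 := @ih z x
    simp only [slt_cons]
    grind

lemma slt_irrefl (x : List ℤ) : ¬ Slt x x := by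
  induction x with
  | nil => simp
  | cons a x ih => simp [slt_cons, ih]

lemma Slt.append {x y : List ℤ} (h : Slt x y) (u v : List ℤ) : Slt (x ++ u) (y ++ v) := by
  obtain ⟨τ, a, b, x', y', rfl, rfl, h⟩ := h
  exact ⟨τ, a, b, x' ++ u, y' ++ v, by simp, by simp, h⟩

lemma Slt.append_left {x y : List ℤ} (h : Slt x y) (u : List ℤ) : Slt (x ++ u) y := by
  simpa using h.append u []

lemma Slt.append_right {x y : List ℤ} (h : Slt x y) (v : List ℤ) : Slt x (y ++ v) := by
  simpa using h.append [] v

lemma not_slt_self_append (x z : List ℤ) : ¬ Slt x (x ++ z) := fun h =>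
  slt_irrefl _ (h.append_left z)

lemma Slt.of_append_right {x y z : List ℤ} (h : Slt x (y ++ z)) (hl : x.length ≤ y.length) :
    Slt x y := by
  obtain ⟨τ, a, b, x', y', rfl, h2, h⟩ := h
  simp at hl
  rcases List.append_eq_append_iff.1 h2 with ⟨c, rfl, -⟩ | ⟨c, rfl, h3⟩
  · simp at hl
    omega
  · rcases c with _ | ⟨d, c⟩
    · simp at hl
    · simp at h3
      obtain ⟨rfl, rfl⟩ := h3
      exact ⟨τ, a, b, x', c, rfl, rfl, h⟩

lemma Slt.of_append_left {x y z : List ℤ} (h : Slt (x ++ z) y) (hl : y.length ≤ x.length) :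
    Slt x y := by
  obtain ⟨τ, a, b, x', y', h2, rfl, h⟩ := h
  simp at hl
  rcases List.append_eq_append_iff.1 h2 with ⟨c, rfl, -⟩ | ⟨c, rfl, h3⟩
  · simp at hl
    omega
  · rcases c with _ | ⟨d, c⟩
    · simp at hl
    · simp at h3
      obtain ⟨rfl, rfl⟩ := h3
      exact ⟨τ, a, b, c, y', rfl, rfl, h⟩

/-- A word followed by `0` lies below `s` either strictly, or because it is a prefix of `s`
followed by a letter of the appropriate sign. -/
lemma slt_append_zero {u s : List ℤ} (h : Slt (u ++ [0]) s) :
    Slt u s ∨ ∃ F v, s = u ++ F :: v ∧ 0 < par u * F := by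
  obtain ⟨τ, a, b, x', y', h2, rfl, h⟩ := h
  rcases List.append_eq_append_iff.1 h2 with ⟨c, rfl, h3⟩ | ⟨c, rfl, h3⟩
  · rcases c with _ | ⟨d, c⟩
    · simp at h3
      obtain ⟨rfl, rfl⟩ := h3
      exact Or.inr ⟨b, y', by simp, by simpa using h⟩
    · simp at h3
  · rcases c with _ | ⟨d, c⟩
    · simp at h3
      obtain ⟨rfl, rfl⟩ := h3
      exact Or.inr ⟨b, y', by simp, by simpa using h⟩
    · simp at h3
      obtain ⟨rfl, rfl⟩ := h3
      exact Or.inl ⟨τ, a, b, c, y', rfl, rfl, h⟩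

lemma slt_of_letter (τ : List ℤ) {a b : ℤ} (x y : List ℤ) (h : par τ * a < par τ * b) :
    Slt (τ ++ a :: x) (τ ++ b :: y) := ⟨τ, a, b, x, y, rfl, rfl, h⟩

lemma exists_first_diff {x y : List ℤ} {j : ℕ} (hx : j < x.length) (hy : j < y.length)
    (h : x.getD j 0 ≠ y.getD j 0) :
    ∃ τ a b x' y', x = τ ++ a :: x' ∧ y = τ ++ b :: y' ∧ a ≠ b := by
  induction x generalizing y j with
  | nil => simp at hx
  | cons a x ih =>
    rcases y with _ | ⟨b, y⟩
    · simp at hy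
    by_cases hab : a = b
    · subst hab
      rcases j with _ | j
      · simp at h
      · obtain ⟨τ, a', b', x', y', rfl, rfl, hd⟩ :=
          ih (y := y) (j := j) (by simpa using hx) (by simpa using hy) (by simpa using h)
        exact ⟨a :: τ, a', b', x', y', rfl, rfl, hd⟩
    · exact ⟨[], a, b, x, y, rfl, rfl, hab⟩

lemma slt_or_slt {x y : List ℤ} {j : ℕ} (hx : j < x.length) (hy : j < y.length)
    (h : x.getD j 0 ≠ y.getD j 0) : Slt x y ∨ Slt y x := by
  obtain ⟨τ, a, b, x', y', rfl, rfl, hab⟩ := exists_first_diff hx hy h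
  rcases par_cases τ with hτ | hτ <;> rcases lt_or_gt_of_ne hab with h | h
  · exact Or.inl (slt_of_letter _ _ _ (by rw [hτ]; linarith))
  · exact Or.inr (slt_of_letter _ _ _ (by rw [hτ]; linarith))
  · exact Or.inr (slt_of_letter _ _ _ (by rw [hτ]; linarith))
  · exact Or.inl (slt_of_letter _ _ _ (by rw [hτ]; linarith))

lemma slt_total {x y : List ℤ} (hl : x.length = y.length) : x = y ∨ Slt x y ∨ Slt y x := by
  by_cases h : ∃ j, j < x.length ∧ x.getD j 0 ≠ y.getD j 0
  · obtain ⟨j, hj, h⟩ := h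
    exact Or.inr (slt_or_slt hj (hl ▸ hj) h)
  · push Not at h
    refine Or.inl (List.ext_getElem hl fun i h1 h2 => ?_)
    simpa [h1, h2] using h i h1

lemma WLex.not_slt_suffix {s v : List ℤ} (hs : WLex s) (hv : v <:+ s) : ¬ Slt s v := by
  obtain ⟨p, rfl⟩ := hv
  intro h
  rcases p with _ | ⟨a, p⟩
  · exact slt_irrefl _ h
  · exact slt_irrefl _ (slt_trans (h.append_right [0]) (hs _ _ rfl (by simp)))

/-- Every suffix of `x ++ a :: y` is a suffix of `y`, or extends to a suffix of `x`. -/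
lemma suffix_append_cons {ρ x y : List ℤ} {a : ℤ} (h : ρ <:+ x ++ a :: y) :
    ρ <:+ y ∨ ∃ ρ', ρ' <:+ x ∧ ρ = ρ' ++ a :: y := by
  obtain ⟨p, h⟩ := h
  rcases List.append_eq_append_iff.1 h with ⟨c, rfl, h3⟩ | ⟨c, rfl, h3⟩
  · exact Or.inr ⟨c, ⟨p, rfl⟩, h3⟩
  · rcases c with _ | ⟨d, c⟩
    · exact Or.inr ⟨[], by simp, by simpa using h3.symm⟩
    · simp at h3
      exact Or.inl ⟨c, h3.2.symm⟩

/-- If `s < ρ ++ a :: z` then the comparison is decided inside `ρ`, or at the letter `a`,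
or after it. -/
lemma slt_append_cons_cases {s ρ z : List ℤ} {a : ℤ} (h : Slt s (ρ ++ a :: z)) :
    (∀ z', Slt s (ρ ++ a :: z')) ∨
      ∃ v, s = ρ ++ a :: v ∧ Slt ((ρ ++ [a]) ++ v) ((ρ ++ [a]) ++ z) := by
  have h0 := h
  obtain ⟨τ, c, d, s', r', rfl, h2, h⟩ := h
  rcases List.append_eq_append_iff.1 h2 with ⟨e, rfl, h3⟩ | ⟨e, rfl, h3⟩
  · rcases e with _ | ⟨f, e⟩
    · simp at h3
      obtain ⟨rfl, rfl⟩ := h3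
      exact Or.inl fun z' => by simpa using slt_of_letter ρ s' z' (by simpa using h)
    · simp at h3
      obtain ⟨rfl, rfl⟩ := h3
      exact Or.inr ⟨e ++ c :: s', by simp, by simpa using h0⟩
  · rcases e with _ | ⟨f, e⟩
    · simp at h3
      obtain ⟨rfl, rfl⟩ := h3
      exact Or.inl fun z' => by simpa using slt_of_letter τ s' z' h
    · simp at h3
      obtain ⟨rfl, rfl⟩ := h3
      exact Or.inl fun z' => ⟨τ, c, d, s', e ++ a :: z', rfl, by simp, h⟩

lemma par_mul_eq {ρ : List ℤ} {a : ℤ} (ha : a = 1 ∨ a = -1) :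
    par ρ * a = 1 ∨ par ρ * a = -1 := by
  rcases par_cases ρ with h | h <;> rcases ha with rfl | rfl <;> simp [h]

lemma par_append_singleton {ρ : List ℤ} {a : ℤ} (ha : a = 1 ∨ a = -1) :
    par (ρ ++ [a]) = - (par ρ * a) := by
  rcases ha with rfl | rfl <;> simp

lemma Wadm.branch {s τ x y : List ℤ} {a b : ℤ} (hs : WLex s) (ha : a = 1 ∨ a = -1)
    (hb : b = 1 ∨ b = -1) (hab : a ≠ b) (hx : Wadm s (τ ++ a :: x))
    (hy : Wadm s (τ ++ b :: y)) : Wadm s (τ ++ a :: s) := by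
  intro ρ hρ h
  rcases suffix_append_cons hρ with h1 | ⟨ρ', ⟨t, rfl⟩, rfl⟩
  · exact hs.not_slt_suffix h1 h
  · rcases slt_append_cons_cases h with h2 | ⟨v, hv, h2⟩
    · exact hx (ρ' ++ a :: x) ⟨t, by simp⟩ (h2 x)
    · have h3 : ¬ par ρ' * a < par ρ' * b := fun h3 =>
        hy (ρ' ++ b :: y) ⟨t, by simp⟩ (hv ▸ slt_of_letter ρ' v y h3)
      have h4 : par ρ' * a = 1 := by
        rcases par_cases ρ' with h | h <;> rcases ha with rfl | rfl <;>
          rcases hb with rfl | rfl <;> simp_all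
      rw [slt_append_left_odd (by rw [par_append_singleton ha, h4])] at h2
      exact hs.not_slt_suffix ⟨ρ' ++ [a], by simp [hv]⟩ h2

lemma getD_append_cons_of_lt {τ x : List ℤ} {a : ℤ} {n : ℕ} (h : τ.length < n) :
    (τ ++ a :: x).getD n 0 = x.getD (n - τ.length - 1) 0 := by
  rw [List.getD_append_right _ _ _ _ h.le]
  obtain ⟨k, rfl⟩ := Nat.exists_eq_add_of_lt h
  have h1 : τ.length + k + 1 - τ.length = k + 1 := by omega
  rw [h1]
  simp

/-- A discrete intermediate value theorem: between two admissible words differing at the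
position `s.length` there is a strictly admissible word of length `s.length`. -/
lemma exists_admissible_between {s : List ℤ} (hs : WLex s) (hbs : Bin s) (k : ℕ) :
    ∀ {τ x y : List ℤ} {a b : ℤ}, s.length ≤ τ.length + k → par τ * a < par τ * b →
      Bin (τ ++ a :: x) → Bin (τ ++ b :: y) →
      Wadm s (τ ++ a :: x) → Wadm s (τ ++ b :: y) →
      s.length < (τ ++ a :: x).length → s.length < (τ ++ b :: y).length →
      (τ ++ a :: x).getD s.length 0 ≠ (τ ++ b :: y).getD s.length 0 →
      ∃ ζ, ζ.length = s.length ∧ Bin ζ ∧ Slt (τ ++ a :: x) (ζ ++ [0]) ∧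
        Slt (ζ ++ [0]) (τ ++ b :: y) ∧ ∀ ρ, ρ <:+ ζ → ρ = s ∨ Slt (ρ ++ [0]) s := by
  induction k with
  | zero =>
    intro τ x y a b hk hab hbx hby hax hay hlx hly hne
    simp only [bin_append, bin_cons] at hbx hby
    have hle : τ.length ≤ s.length := by
      by_contra hlt
      push Not at hlt
      exact hne (by rw [List.getD_append _ _ _ _ hlt, List.getD_append _ _ _ _ hlt])
    have ha := par_mul_eq (ρ := τ) hbx.2.1
    have hb := par_mul_eq (ρ := τ) hby.2.1
    refine ⟨τ, by omega, hbx.1, slt_of_letter _ _ _ (by omega), slt_of_letter _ _ _ (by omega),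
      ?_⟩
    rintro ρ ⟨t, rfl⟩
    have hρx : ¬ Slt s (ρ ++ a :: x) := hax _ ⟨t, by simp⟩
    have hρy : ¬ Slt s (ρ ++ b :: y) := hay _ ⟨t, by simp⟩
    have hne : a ≠ b := by rintro rfl; omega
    have hρl : ρ.length ≤ s.length := by
      simp at hle hk
      omega
    obtain ⟨s₁, s₂, rfl, hs₁⟩ : ∃ s₁ s₂, s = s₁ ++ s₂ ∧ ρ.length = s₁.length :=
      ⟨s.take ρ.length, s.drop ρ.length, by simp, by simpa using hρl⟩
    rcases slt_total hs₁ with rfl | h | h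
    · rcases s₂ with _ | ⟨F, v⟩
      · simp
      · right
        refine slt_of_letter _ _ _ ?_
        have hFx : ¬ par ρ * F < par ρ * a := fun h => hρx (slt_of_letter _ _ _ h)
        have hFy : ¬ par ρ * F < par ρ * b := fun h => hρy (slt_of_letter _ _ _ h)
        simp only [bin_append, bin_cons] at hbs
        rcases par_cases ρ with h | h <;> rw [h] at hFx hFy ⊢ <;> omega
    · exact Or.inr (h.append _ _)
    · exact absurd (h.append _ _) hρx
  | succ k ih =>
    intro τ x y a b hk hab hbx hby hax hay hlx hly hne
    by_cases hlt : s.length ≤ τ.length + k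
    · exact ih hlt hab hbx hby hax hay hlx hly hne
    simp only [bin_append, bin_cons] at hbx hby
    simp only [List.length_append, List.length_cons] at hlx hly
    have hτ : τ.length < s.length := by
      by_contra hlt'
      have hlt' : s.length < τ.length := by omega
      exact hne (by rw [List.getD_append _ _ _ _ hlt', List.getD_append _ _ _ _ hlt'])
    have ha := par_mul_eq (ρ := τ) hbx.2.1
    have hb := par_mul_eq (ρ := τ) hby.2.1
    have hne' : a ≠ b := by rintro rfl; omega
    have hpa : par (τ ++ [a]) = 1 := by rw [par_append_singleton hbx.2.1]; omega
    have hpb : par (τ ++ [b]) = -1 := by rw [par_append_singleton hby.2.1]; omega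
    rw [getD_append_cons_of_lt hτ, getD_append_cons_of_lt hτ] at hne
    have hj : s.length - τ.length - 1 < s.length := by omega
    by_cases hc : x.getD (s.length - τ.length - 1) 0 = s.getD (s.length - τ.length - 1) 0
    · have hd : y.getD (s.length - τ.length - 1) 0 ≠ s.getD (s.length - τ.length - 1) 0 :=
        fun h => hne (hc.trans h.symm)
      have hys : Slt y s := (slt_or_slt (by omega) hj hd).resolve_right
        (hay y ⟨τ ++ [b], by simp⟩)
      have had := hay.branch hs hby.2.1 hbx.2.1 hne'.symm hax
      have hdd : (τ ++ b :: s).getD s.length 0 ≠ (τ ++ b :: y).getD s.length 0 := by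
        rw [getD_append_cons_of_lt hτ, getD_append_cons_of_lt hτ]
        exact hd.symm
      obtain ⟨τ', c, d, y', s', rfl, hs', hcd⟩ := hys
      have hcat : ∀ z, τ ++ b :: (τ' ++ z) = (τ ++ [b] ++ τ') ++ z := by simp
      have hbs' : Bin (τ ++ b :: s) := by simp [hby.1, hby.2.1, hbs]
      have hls : s.length < (τ ++ b :: s).length := by simp; omega
      have hb' : Bin (τ ++ b :: (τ' ++ c :: y')) := by simpa using hby
      rw [show τ ++ b :: s = (τ ++ [b] ++ τ') ++ d :: s' by rw [hs', hcat]] at had hdd hbs' hls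
      rw [hcat] at hay hdd hb'
      obtain ⟨ζ, h1, h2, h3, h4, h5⟩ := ih (by simp; omega)
        (by rw [par_append (τ ++ [b]), hpb]; linarith) hbs' hb' had hay hls
        (by simp at hly ⊢; omega) hdd
      refine ⟨ζ, h1, h2, slt_trans ?_ h3, by rw [hcat]; exact h4, h5⟩
      rw [← hcat]
      exact slt_of_letter _ _ _ hab
    · have hxs : Slt x s := (slt_or_slt (by omega) hj hc).resolve_right
        (hax x ⟨τ ++ [a], by simp⟩)
      have had := hax.branch hs hbx.2.1 hby.2.1 hne' hay
      have hdd : (τ ++ a :: x).getD s.length 0 ≠ (τ ++ a :: s).getD s.length 0 := by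
        rw [getD_append_cons_of_lt hτ, getD_append_cons_of_lt hτ]
        exact hc
      obtain ⟨τ', c, d, x', s', rfl, hs', hcd⟩ := hxs
      have hcat : ∀ z, τ ++ a :: (τ' ++ z) = (τ ++ [a] ++ τ') ++ z := by simp
      have hbs' : Bin (τ ++ a :: s) := by simp [hbx.1, hbx.2.1, hbs]
      have hls : s.length < (τ ++ a :: s).length := by simp; omega
      have hb' : Bin (τ ++ a :: (τ' ++ c :: x')) := by simpa using hbx
      rw [show τ ++ a :: s = (τ ++ [a] ++ τ') ++ d :: s' by rw [hs', hcat]] at had hdd hbs' hls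
      rw [hcat] at hax hdd hb'
      obtain ⟨ζ, h1, h2, h3, h4, h5⟩ := ih (by simp; omega)
        (by rw [par_append (τ ++ [a]), hpa]; linarith) hb' hbs' hax had
        (by simp at hlx ⊢; omega) hls hdd
      refine ⟨ζ, h1, h2, by rw [hcat]; exact h3, slt_trans h4 ?_, h5⟩
      rw [← hcat]
      exact slt_of_letter _ _ _ hab

lemma WLex.not_slt_append_cons {s ρ z p : List ℤ} {E : ℤ} (hs : WLex s) (hρ : s = p ++ ρ)
    (hp : p ≠ []) (hbs : Bin s) (hE : E = 1 ∨ E = -1) (hz : ∀ v, v <:+ s → ¬ Slt z v) :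
    ¬ Slt s (ρ ++ E :: z) := by
  intro h
  rcases slt_append_zero (hs p ρ hρ hp) with h1 | ⟨F, v, hv, hF⟩
  · exact slt_irrefl _ (slt_trans h (h1.append_left _))
  · have hF1 : F = 1 ∨ F = -1 := by
      rw [hv] at hbs
      simp only [bin_append, bin_cons] at hbs
      exact hbs.2.1
    rcases slt_append_cons_cases h with h2 | ⟨v', hv', h2⟩
    · have h3 := h2 v
      rw [hv] at h3
      by_cases hEF : E = F
      · exact slt_irrefl _ (hEF ▸ h3)
      · have hE' := par_mul_eq (ρ := ρ) hE
        have hF' := par_mul_eq (ρ := ρ) hF1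
        refine slt_irrefl _ (slt_trans h3 (slt_of_letter _ _ _ ?_))
        rcases par_cases ρ with h | h <;> rw [h] at hE' hF' hF ⊢ <;> omega
    · have hFE : F = E ∧ v = v' := by simpa using hv.symm.trans hv'
      obtain ⟨rfl, rfl⟩ := hFE
      have := par_mul_eq (ρ := ρ) hF1
      rw [slt_append_left_odd (by rw [par_append_singleton hF1]; omega)] at h2
      exact hz v ⟨ρ ++ [F], by simp [hv]⟩ h2

/-- Flipping the letter after the prefix `s` of a shift-maximal word `s ++ X :: σ`, whose
tail `σ` is as large as possible, gives a shift-maximal word. -/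
theorem WLex.flip {s σ : List ℤ} {X : ℤ} (hX : X = 1 ∨ X = -1) (hbs : Bin s)
    (hlen : σ.length = s.length) (hs : WLex s) (hsX : par s * X = -1)
    (hα : WLex (s ++ X :: σ))
    (hmax : ∀ ζ, Bin ζ → ζ.length = s.length → WLex (s ++ X :: ζ) →
      ¬ Slt (σ ++ [0]) (ζ ++ [0])) : WLex (s ++ (-X) :: σ) := by
  have hlt : par s * X < par s * (-X) := by rw [mul_neg]; omega
  intro p' ρ h hp'
  rcases suffix_append_cons ⟨p', h.symm⟩ with ⟨c, rfl⟩ | ⟨u, ⟨p, rfl⟩, rfl⟩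
  · exact slt_trans (hα (s ++ X :: c) ρ (by simp) (by simp)) (slt_of_letter _ _ _ hlt)
  have hp : p ≠ [] := by
    rintro rfl
    apply hp'
    simpa using h
  rcases slt_append_zero (hs p u rfl hp) with h1 | ⟨F, v, hv, hF⟩
  · simpa using h1.append ((-X) :: (σ ++ [0])) ((-X) :: σ)
  have hF1 : F = 1 ∨ F = -1 := by
    rw [hv] at hbs
    simp only [bin_append, bin_cons] at hbs
    exact hbs.2.1
  have huF := par_mul_eq (ρ := u) hF1
  have hXF : F = X ∨ F = -X := by omega
  rw [hv]
  rcases hXF with rfl | rfl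
  · simpa using slt_of_letter u (σ ++ [0]) (v ++ (-F) :: σ) (by rw [mul_neg]; omega)
  -- the remaining case: `u` is a border of `s` followed by the letter `-X`
  have hu : par u * (-X) = 1 := by omega
  suffices hgoal : Slt (v ++ (-X) :: σ) (σ ++ [0]) by
    have := (slt_append_left_odd (τ := u ++ [-X]) (x := σ ++ [0]) (y := v ++ (-X) :: σ)
      (by rw [par_append_singleton hF1, hu])).2 hgoal
    simpa using this
  by_contra hcon
  have hbv : Bin v ∧ Bin u := by
    rw [hv] at hbs
    simp only [bin_append, bin_cons] at hbs
    exact ⟨hbs.2.2, hbs.1⟩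
  have hmX : (-X) = 1 ∨ (-X) = -1 := by omega
  have hpv : par v * X = 1 := by
    have h2 : par (p ++ u) = par u * par [-X] * par v := by
      rw [hv]; simp
    have h3 : par [-X] = X := by rcases hX with rfl | rfl <;> simp
    rw [h2, h3] at hsX
    rw [mul_neg] at hu
    have h5 : X * X = 1 := by rcases hX with rfl | rfl <;> simp
    nlinarith
  have hvs : Slt v (p ++ u) := by
    rcases slt_append_zero (hs (u ++ [-X]) v (by simp [hv]) (by simp)) with h2 | ⟨E, z, hz, hE⟩
    · exact h2
    · exfalso
      have hl : z.length = u.length := by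
        have := congrArg List.length (hv.symm.trans hz)
        simp at this
        omega
      have hzu : z = u := by
        have h2 : p ++ u = (v ++ [E]) ++ z := by simp [hz]
        exact ((List.append_inj_right' h2 hl.symm)).symm
      subst hzu
      have h2 := congrArg par hz
      have h3 := congrArg par hv
      have hE1 : E = 1 ∨ E = -1 := by
        rw [hz] at hbs
        simp only [bin_append, bin_cons] at hbs
        exact hbs.2.1
      have hEX : E = X := by
        rcases par_cases v with h | h <;> rw [h] at hE hpv <;> omega
      subst hEX
      rw [h2] at h3
      have h4 := par_cases v
      have h5 := par_cases z
      simp only [par_append, par_cons] at h3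
      rcases hX with rfl | rfl <;> norm_num at h3 <;> grind
  have hus : ∀ w, w <:+ p ++ u → ¬ Slt (u ++ [-X]) w := by
    intro w hw h2
    apply hs.not_slt_suffix hw
    rw [hv]
    simpa using h2.append_left v
  have hlv : (p ++ u).length = u.length + v.length + 1 := by
    rw [hv]; simp; omega
  obtain ⟨ζ, hζl, hζb, hζ1, hζ2, hζ3⟩ : ∃ ζ, ζ.length = (p ++ u).length ∧ Bin ζ ∧
      Slt (v ++ X :: (u ++ [-X])) (ζ ++ [0]) ∧ Slt (ζ ++ [0]) ((p ++ u) ++ [X]) ∧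
      ∀ ρ, ρ <:+ ζ → ρ = p ++ u ∨ Slt (ρ ++ [0]) (p ++ u) := by
    obtain ⟨τ, a, b, x, y, hx, hy, hab⟩ := hvs.append (X :: (u ++ [-X])) [X]
    rw [hx, hy]
    have hwx : Wadm (p ++ u) (v ++ X :: (u ++ [-X])) := by
      intro ρ hρ
      rcases suffix_append_cons hρ with h2 | ⟨ρ', ⟨t, rfl⟩, rfl⟩
      · rcases suffix_append_cons h2 with h3 | ⟨ρ', ⟨t, rfl⟩, rfl⟩
        · simp only [List.suffix_nil] at h3
          simp [h3]
        · exact hs.not_slt_append_cons (p := p ++ t) (by simp) (by simp [hp]) hbs hmX (by simp)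
      · exact hs.not_slt_append_cons (p := u ++ [-X] ++ t) (by simp [hv]) (by simp) hbs hX hus
    have hwy : Wadm (p ++ u) ((p ++ u) ++ [X]) := by
      intro ρ hρ
      rcases suffix_append_cons hρ with h2 | ⟨ρ', ⟨t, ht⟩, rfl⟩
      · simp only [List.suffix_nil] at h2
        simp [h2]
      · rcases t with _ | ⟨c, t⟩
        · simp at ht
          subst ht
          exact not_slt_self_append _ _
        · exact hs.not_slt_append_cons ht.symm (by simp) hbs hX (by simp)
    have hne : (v ++ X :: (u ++ [-X])).getD (p ++ u).length 0 ≠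
        ((p ++ u) ++ [X]).getD (p ++ u).length 0 := by
      rw [getD_append_cons_of_lt (by omega), List.getD_append_right _ _ _ _ le_rfl,
        List.getD_append_right _ _ _ _ (by omega)]
      have : (p ++ u).length - v.length - 1 - u.length = 0 := by omega
      rw [this]
      simp
      omega
    have hlx : (p ++ u).length < (v ++ X :: (u ++ [-X])).length := by
      rw [hlv]; simp; omega
    have hly : (p ++ u).length < ((p ++ u) ++ [X]).length := by simp
    have hbx : Bin (v ++ X :: (u ++ [-X])) := by
      simp only [bin_append, bin_cons]
      exact ⟨hbv.1, hX, hbv.2, hmX, bin_nil⟩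
    have hby : Bin ((p ++ u) ++ [X]) := by
      simp only [bin_append, bin_cons] at hbs ⊢
      exact ⟨hbs, hX, bin_nil⟩
    rw [hx] at hwx hne hlx hbx
    rw [hy] at hwy hne hly hby
    exact exists_admissible_between hs hbs (p ++ u).length (by omega) hab hbx hby hwx hwy hlx hly
      hne
  have hσζ : Slt (σ ++ [0]) (ζ ++ [0]) := by
    have hvX : Slt (v ++ (-X) :: σ) (v ++ X :: (u ++ [-X])) :=
      slt_of_letter _ _ _ (by rw [mul_neg]; omega)
    rcases slt_total (x := σ ++ [0]) (y := ζ ++ [0]) (by simp; simp at hlen hζl; omega)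
      with h2 | h2 | h2
    · exact absurd (slt_trans hvX (h2 ▸ hζ1)) hcon
    · exact h2
    · exact absurd (slt_trans hvX (slt_trans hζ1 h2)) hcon
  refine hmax ζ hζb hζl ?_ hσζ
  clear hcon h hp'
  intro p' ρ h hp'
  rcases suffix_append_cons ⟨p', h.symm⟩ with h2 | ⟨u₂, ⟨p₂, h2⟩, rfl⟩
  · rcases hζ3 ρ h2 with h3 | h3
    · have h4 : ρ = ζ := h2.eq_of_length (by rw [h3, hζl])
      rw [← h4, h3] at hζ2
      exfalso
      have := slt_irrefl _ (slt_trans hζ2 (slt_of_letter (p ++ u) [] [] (by rw [hsX]; simp)))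
      exact this
    · exact h3.append_right _
  · have hp₂ : p₂ ≠ [] := by
      rintro rfl
      apply hp'
      simp at h2
      rw [h2] at h
      simpa using h
    rcases slt_append_zero (hs p₂ u₂ h2.symm hp₂) with h3 | ⟨F, v₂, hv₂, hF⟩
    · simpa using h3.append (X :: (ζ ++ [0])) (X :: ζ)
    have hFv : F = 1 ∨ F = -1 := by
      rw [hv₂] at hbs
      simp only [bin_append, bin_cons] at hbs
      exact hbs.2.1
    have huF := par_mul_eq (ρ := u₂) hFv
    have hXF : F = X ∨ F = -X := by omega
    have hασ := hα p₂ (u₂ ++ X :: σ) (by simp [← h2]) hp₂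
    rw [hv₂] at hασ ⊢
    rcases hXF with rfl | rfl
    · have hodd : par (u₂ ++ [F]) = -1 := by
        rw [par_append_singleton hFv]; omega
      have h4 := (slt_append_left_odd (x := σ ++ [0]) (y := v₂ ++ F :: σ) hodd).1
        (by simpa using hασ)
      have h5 : par (v₂ ++ [F]) = -1 := by
        rw [par_append_singleton hFv]
        have h6 : par (p ++ u) = par u₂ * par [F] * par v₂ := by
          rw [hv₂]; simp
        have h3 : par [F] = -F := by rcases hFv with rfl | rfl <;> simp
        rw [h6, h3] at hsX
        have h7 : par u₂ * F = 1 := by omega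
        nlinarith
      have h6 : Slt (v₂ ++ F :: (ζ ++ [0])) (v₂ ++ F :: (σ ++ [0])) := by
        simpa using (slt_append_left_odd (x := ζ ++ [0]) (y := σ ++ [0]) h5).2 hσζ
      have h7 : Slt (v₂ ++ F :: (σ ++ [0])) (σ ++ [0]) := by
        simpa using h4.append_left [0]
      have h8 : Slt ((v₂ ++ F :: ζ) ++ [0]) (ζ ++ [0]) := by
        simpa using slt_trans h6 (slt_trans h7 hσζ)
      have h9 := h8.of_append_left (by simp)
      simpa using (slt_append_left_odd hodd).2 h9
    · simpa using slt_of_letter u₂ (ζ ++ [0]) (v₂ ++ X :: ζ) (by linarith)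

/-- The word of a sequence: an entry `a` becomes `1` followed by `a - 1` letters `-1`. -/
def word : List ℕ → List ℤ
  | [] => []
  | a :: l => 1 :: (List.replicate (a - 1) (-1) ++ word l)

@[simp] lemma word_append (x y : List ℕ) : word (x ++ y) = word x ++ word y := by
  induction x with
  | nil => rfl
  | cons a x ih => simp [word, ih]

lemma bin_word (x : List ℕ) : Bin (word x) := by
  induction x with
  | nil => simp [word]
  | cons a x ih =>
    simp only [word, bin_cons, bin_append]
    exact ⟨by simp, fun b hb => Or.inr (List.eq_of_mem_replicate hb), ih⟩

lemma length_word {x : List ℕ} (h : ∀ a ∈ x, 0 < a) : (word x).length = x.sum := by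
  induction x with
  | nil => rfl
  | cons a x ih =>
    have := h a (by simp)
    simp [word, ih fun b hb => h b (by simp [hb])]
    omega

lemma par_replicate_neg (n : ℕ) : par (List.replicate n (-1)) = 1 := by
  simp [par]

lemma par_word (x : List ℕ) : par (word x) = (-1) ^ x.length := by
  induction x with
  | nil => rfl
  | cons a x ih => simp [word, par_replicate_neg, ih, pow_succ]

lemma Al_cons_zero (a : ℕ) (x : List ℕ) : Al (a :: x) 0 = a := by simp [Al]

lemma Al_cons_succ (a : ℕ) (x : List ℕ) (i : ℕ) : Al (a :: x) (i + 1) = - Al x i := by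
  simp [Al, pow_succ]

lemma Al_nil (i : ℕ) : Al [] i = 0 := by simp [Al]

lemma lexLt_cons {a b : ℕ} {x y : List ℕ} :
    lexLt (a :: x) (b :: y) ↔ a < b ∨ (a = b ∧ lexLt y x) := by
  constructor
  · rintro ⟨_ | i, h1, h2⟩
    · left
      simpa [Al_cons_zero] using h2
    · right
      refine ⟨by simpa [Al_cons_zero] using h1 0 (by omega), i, fun j hj => ?_, ?_⟩
      · have := h1 (j + 1) (by omega)
        rw [Al_cons_succ, Al_cons_succ] at this
        omega
      · rw [Al_cons_succ, Al_cons_succ] at h2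
        omega
  · rintro (h | ⟨rfl, i, h1, h2⟩)
    · exact ⟨0, by simp, by simpa [Al_cons_zero] using h⟩
    · refine ⟨i + 1, ?_, ?_⟩
      · rintro (_ | j) hj
        · simp [Al_cons_zero]
        · rw [Al_cons_succ, Al_cons_succ, h1 j (by omega)]
      · rw [Al_cons_succ, Al_cons_succ]
        omega

lemma lexLt_nil_cons {b : ℕ} (hb : 0 < b) (y : List ℕ) : lexLt [] (b :: y) :=
  ⟨0, by simp, by simpa [Al_nil, Al_cons_zero] using hb⟩

lemma not_lexLt_cons_nil {a : ℕ} (ha : 0 < a) (x : List ℕ) : ¬ lexLt (a :: x) [] := by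
  rintro ⟨_ | i, h1, h2⟩
  · simp [Al_nil, Al_cons_zero] at h2
    omega
  · have := h1 0 (by omega)
    simp [Al_nil, Al_cons_zero] at this
    omega

lemma not_lexLt_nil_nil : ¬ lexLt [] [] := by
  rintro ⟨i, -, h⟩
  simp at h

lemma slt_replicate_append (n : ℕ) (x y : List ℤ) :
    Slt (List.replicate n (-1) ++ x) (List.replicate n (-1) ++ y) ↔ Slt x y :=
  slt_append_left_even (par_replicate_neg n)

lemma slt_neg_cons_word (z : List ℤ) (x : List ℕ) : Slt (-1 :: z) (word x ++ [0]) := by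
  rcases x with _ | ⟨a, x⟩ <;> simp [word, slt_cons]

lemma slt_replicate_word_of_lt {m n : ℕ} (h : m < n) (z : List ℤ) (x : List ℕ) :
    Slt (List.replicate n (-1) ++ z) (List.replicate m (-1) ++ (word x ++ [0])) := by
  obtain ⟨k, rfl⟩ : ∃ k, n = m + (k + 1) := ⟨n - m - 1, by omega⟩
  rw [List.replicate_add, List.append_assoc, slt_replicate_append]
  exact slt_neg_cons_word _ x

lemma lexLt_iff_slt {x y : List ℕ} (hx : ∀ a ∈ x, 0 < a) (hy : ∀ a ∈ y, 0 < a) :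
    lexLt x y ↔ Slt (word x ++ [0]) (word y ++ [0]) := by
  suffices H : (lexLt x y ↔ Slt (word x ++ [0]) (word y ++ [0])) ∧
      (lexLt y x ↔ Slt (word y ++ [0]) (word x ++ [0])) from H.1
  have step : ∀ {a b : ℕ} {x y : List ℕ}, 0 < a → 0 < b →
      (lexLt y x ↔ Slt (word y ++ [0]) (word x ++ [0])) →
      (lexLt (a :: x) (b :: y) ↔ Slt (word (a :: x) ++ [0]) (word (b :: y) ++ [0])) := by
    intro a b x y ha hb ih
    rw [lexLt_cons]
    simp only [word, List.cons_append, List.append_assoc, slt_cons, lt_irrefl, false_or, true_and,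
      ne_eq, not_true_eq_false, false_and, or_false]
    rcases lt_trichotomy a b with h | rfl | h
    · exact iff_of_true (Or.inl h) (slt_replicate_word_of_lt (by omega) _ _)
    · simp [slt_replicate_append, ih]
    · refine iff_of_false (by omega) fun h' => ?_
      exact slt_irrefl _ (slt_trans h' (slt_replicate_word_of_lt (by omega) _ _))
  induction x generalizing y with
  | nil =>
    rcases y with _ | ⟨b, y⟩
    · simpa [word, slt_irrefl] using not_lexLt_nil_nil
    · have hb := hy b (by simp)
      simp [word, slt_cons, lexLt_nil_cons hb, not_lexLt_cons_nil hb]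
  | cons a x ih =>
    have ha := hx a (by simp)
    rcases y with _ | ⟨b, y⟩
    · simp [word, slt_cons, lexLt_nil_cons ha, not_lexLt_cons_nil ha]
    have hb := hy b (by simp)
    have := ih (y := y) (fun c hc => hx c (by simp [hc])) (fun c hc => hy c (by simp [hc]))
    exact ⟨step ha hb this.2, step hb ha this.1⟩

lemma exists_word_eq {z : List ℤ} (hz : Bin z) :
    ∃ x : List ℕ, (∀ a ∈ x, 0 < a) ∧ word x = 1 :: z := by
  induction z with
  | nil => exact ⟨[1], by simp, rfl⟩
  | cons c z ih =>
    rw [bin_cons] at hz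
    obtain ⟨_ | ⟨a, l⟩, hpos, hw⟩ := ih hz.2
    · simp [word] at hw
    rcases hz.1 with rfl | rfl
    · exact ⟨1 :: a :: l, by simpa using hpos, by simp [word] at hw ⊢; exact hw⟩
    · refine ⟨(a + 1) :: l, by simp at hpos ⊢; exact hpos.2, ?_⟩
      obtain ⟨b, rfl⟩ : ∃ b, a = b + 1 := ⟨a - 1, by have := hpos a (by simp); omega⟩
      simp only [word, List.cons.injEq, true_and, Nat.add_sub_cancel] at hw ⊢
      rw [List.replicate_succ, List.cons_append, hw]

lemma exists_split_of_word_eq {α : List ℕ} {p ρ : List ℤ} (h : word α = p ++ 1 :: ρ) :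
    ∃ α₁ α₂, α = α₁ ++ α₂ ∧ word α₁ = p ∧ word α₂ = 1 :: ρ := by
  induction α generalizing p with
  | nil => simp [word] at h
  | cons a l ih =>
    rcases p with _ | ⟨c, p⟩
    · exact ⟨[], a :: l, rfl, rfl, h⟩
    simp only [word, List.cons_append, List.cons.injEq] at h
    obtain ⟨rfl, h⟩ := h
    rcases List.append_eq_append_iff.1 h with ⟨q, hp, hl⟩ | ⟨q, hr, hl⟩
    · obtain ⟨α₁, α₂, rfl, rfl, h2⟩ := ih hl
      exact ⟨a :: α₁, α₂, rfl, by simp [word, hp], h2⟩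
    · rcases q with _ | ⟨d, q⟩
      · simp only [List.append_nil, List.nil_append] at hr hl
        exact ⟨[a], l, rfl, by simp [word, hr], hl.symm⟩
      · simp only [List.cons_append, List.cons.injEq] at hl
        have : (1 : ℤ) ∈ List.replicate (a - 1) (-1) := by
          rw [hr]
          simp [hl.1]
        have := List.eq_of_mem_replicate this
        omega

lemma word_ne_nil {x : List ℕ} (h : x ≠ []) : word x ≠ [] := by
  rcases x with _ | ⟨a, x⟩
  · exact absurd rfl h
  · simp [word]

lemma isLexical_iff_wLex {α : List ℕ} (hα : IsAlphaSeq α) : IsLexical α ↔ WLex (word α) := by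
  constructor
  · rintro ⟨-, h⟩ p u hpu hp
    obtain ⟨a, l, rfl⟩ := List.exists_cons_of_ne_nil hα.1
    rcases u with _ | ⟨c, ρ⟩
    · simp [word, slt_cons]
    have hbin := bin_word (a :: l)
    rw [hpu, bin_append, bin_cons] at hbin
    rcases hbin.2.1 with rfl | rfl
    · obtain ⟨α₁, α₂, he, rfl, h2⟩ := exists_split_of_word_eq hpu
      have hα₁ : α₁ ≠ [] := by
        rintro rfl
        exact hp rfl
      have hα₂ : α₂ ≠ [] := by
        rintro rfl
        simp [word] at h2
      have hlt := h (α₁.length + 1) (by have := List.length_pos_iff.2 hα₁; omega)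
        (by rw [he, List.length_append]; have := List.length_pos_iff.2 hα₂; omega)
      have hd : (a :: l).drop (α₁.length + 1 - 1) = α₂ := by simp [he]
      rw [hd, lexLt_iff_slt (fun b hb => hα.2 b (by simp [he, hb])) hα.2, h2] at hlt
      refine hlt.of_append_right ?_
      have := congrArg List.length hpu
      have := List.length_pos_iff.2 hp
      simp only [List.length_append, List.length_cons, List.length_nil] at *
      omega
    · simp [word, slt_cons]
  · intro h
    refine ⟨hα, fun i hi hi' => ?_⟩
    rw [lexLt_iff_slt (fun b hb => hα.2 b (List.mem_of_mem_drop hb)) hα.2]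
    refine (h (word (α.take (i - 1))) _ ?_ (word_ne_nil ?_)).append_right _
    · rw [← word_append, List.take_append_drop]
    · rw [ne_eq, List.take_eq_nil_iff]
      have := hα.1
      simp [this]
      omega

lemma word_bumpLast {g : List ℕ} (hg : IsAlphaSeq g) : word (bumpLast g) = word g ++ [-1] := by
  obtain ⟨l, a, rfl⟩ := List.eq_nil_or_concat' g |>.resolve_left hg.1
  obtain ⟨b, rfl⟩ : ∃ b, a = b + 1 := ⟨a - 1, by have := hg.2 a (by simp); omega⟩
  simp [bumpLast, word, List.replicate_succ']

lemma word_seqE {g : List ℕ} (hg : IsAlphaSeq g) :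
    word (seqE g) = word g ++ [-(-1) ^ g.length] := by
  rw [seqE]
  split_ifs with h
  · rw [word_bumpLast hg, h.neg_one_pow]
  · simp [(Nat.not_even_iff_odd.1 h).neg_one_pow, word]

lemma word_seqO {g : List ℕ} (hg : IsAlphaSeq g) :
    word (seqO g) = word g ++ [-(-(-1) ^ g.length)] := by
  rw [seqO]
  split_ifs with h
  · simp [h.neg_one_pow, word]
  · rw [word_bumpLast hg, (Nat.not_even_iff_odd.1 h).neg_one_pow, neg_neg]

lemma IsAlphaSeq.seqO {g : List ℕ} (hg : IsAlphaSeq g) : IsAlphaSeq (seqO g) := by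
  rw [_root_.seqO]
  split_ifs
  · refine ⟨by simp, fun a ha => ?_⟩
    rcases List.mem_append.1 ha with ha | ha
    · exact hg.2 a ha
    · simp_all
  · refine ⟨by simp [bumpLast], fun a ha => ?_⟩
    rcases List.mem_append.1 ha with ha | ha
    · exact hg.2 a (List.mem_of_mem_dropLast ha)
    · simp_all

/-- if `α = g_e σ` and `β = g_o κ` are adjacent in `L_{2m}` with
`g ∈ L_m` fundamental, then `g_o σ ∈ L_{2m}`. -/
theorem stmt_8 (m : ℕ) (hm : 2 ≤ m) (g : List ℕ) (hg : g ∈ Lset m)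
    (hfund : IsFundamental g)
    (σ κ : List ℕ) (hσ : IsAlphaSeq σ) (hκ : IsAlphaSeq κ)
    (hα : seqE g ++ σ ∈ Lset (2 * m)) (hβ : seqO g ++ κ ∈ Lset (2 * m))
    (hadj : AdjLtIn (Lset (2 * m)) (seqE g ++ σ) (seqO g ++ κ)) :
    seqO g ++ σ ∈ Lset (2 * m) := by
  obtain ⟨hgl, hgm⟩ := hg
  have hga := hgl.1
  obtain ⟨hαl, hαm⟩ := hα
  have hlg := length_word hga.2
  have hlσ := length_word hσ.2
  have hlα := length_word hαl.1.2
  have hwE := word_seqE hga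
  have hwO := word_seqO hga
  have hXc : (-(-1) ^ g.length : ℤ) = 1 ∨ (-(-1) ^ g.length : ℤ) = -1 := by
    rcases neg_one_pow_eq_or ℤ g.length with h | h <;> simp [h]
  have hsX : par (word g) * (-(-1) ^ g.length) = -1 := by
    rw [par_word]
    rcases neg_one_pow_eq_or ℤ g.length with h | h <;> simp [h]
  have hpar : par (word g ++ [-(-1) ^ g.length]) = 1 := by
    rw [par_append, par_word]
    rcases neg_one_pow_eq_or ℤ g.length with h | h <;> simp [h]
  generalize (-(-1) ^ g.length : ℤ) = X at *
  have hwα : word (seqE g ++ σ) = word g ++ X :: word σ := by simp [hwE]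
  have hlen : (word σ).length = (word g).length := by
    rw [hwα] at hlα
    simp only [List.length_append, List.length_cons] at hlα
    omega
  have hflip : WLex (word g ++ (-X) :: word σ) := by
    refine WLex.flip hXc (bin_word g) hlen ((isLexical_iff_wLex hga).1 hgl) hsX
      (hwα ▸ (isLexical_iff_wLex hαl.1).1 hαl) fun ζ hζ hζl hζw hlt => ?_
    obtain ⟨z, hz⟩ : ∃ z, word g = 1 :: z := by
      obtain ⟨a, l, rfl⟩ := List.exists_cons_of_ne_nil hga.1
      exact ⟨_, rfl⟩
    have hbin : Bin (z ++ X :: ζ) := by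
      have := bin_word g
      rw [hz, bin_cons] at this
      simp [this.2, hXc, hζ]
    obtain ⟨γ, hγpos, hγ⟩ := exists_word_eq hbin
    rw [← List.cons_append, ← hz] at hγ
    have hγa : IsAlphaSeq γ := by
      refine ⟨?_, hγpos⟩
      rintro rfl
      simp [word] at hγ
    have hγl : IsLexical γ := (isLexical_iff_wLex hγa).2 (hγ ▸ hζw)
    refine hadj.2 γ ⟨hγl, ?_⟩ ⟨?_, ?_⟩
    · rw [← length_word hγpos, hγ]
      simp only [List.length_append, List.length_cons]
      omega
    · rw [lexLt_iff_slt hαl.1.2 hγpos, hwα, hγ]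
      have h := (slt_append_left_even hpar).2 hlt
      simpa using h
    · rw [lexLt_iff_slt hγpos hβ.1.1.2, hγ, word_append, hwO]
      have h := slt_of_letter (word g) (a := X) (b := -X) (ζ ++ [0]) (word κ ++ [0])
        (by rw [mul_neg]; omega)
      simpa using h
  have hOa : IsAlphaSeq (seqO g ++ σ) := by
    refine ⟨by simp [hσ.1], fun a ha => ?_⟩
    rcases List.mem_append.1 ha with ha | ha
    · exact hga.seqO.2 a ha
    · exact hσ.2 a ha
  have hwO' : word (seqO g ++ σ) = word g ++ (-X) :: word σ := by simp [hwO]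
  refine ⟨(isLexical_iff_wLex hOa).2 (hwO' ▸ hflip), ?_⟩
  rw [← length_word hOa.2, hwO']
  simp only [List.length_append, List.length_cons]
  omega
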